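/- Fix (z,w) ∈ Λ with z ∈ {0,1} or w ∈ {0,1}. Then Λ_{λ,ξ}(z,w) ⊆ W_{λ,ξ}(z,w), and W_{λ,ξ}(z,w) ⊆ ⋃_{(r,s)∈{−1,0,1}²} Λ_{λ,ξ}(z+r, w+s), where for an arbitrary point (z',w') ∈ ℝ² the set Λ_{λ,ξ}(z',w') is defined by the same formula, i.e. Λ_{λ,ξ}(z',w') = {(x,y) ∈ Λ : Tⁿ(x,y) ∈ [z'−b^{−λ(n)}, z'+b^{−λ(n)}] × [w'−b^{−ξ(n)}, w'+b^{−ξ(n)}] for infinitely many n ∈ ℕ}. -/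

import Mathlib

open Set Filter Topology MeasureTheory
open scoped ENNReal NNReal Topology

noncomputable section

namespace ShrinkingRect

/-- The real number with 1-indexed base-`b` digit sequence `u` (digit `i` is `u i` for `i ≥ 1`). -/
def val (b : ℕ) (u : ℕ → ℕ) : ℝ := ∑' i : ℕ, (u (i + 1) : ℝ) / (b : ℝ) ^ (i + 1)

/-- The self-similar carpet `Λ` with digit set `J ⊆ {0,…,b−1}²`. -/
def carpet (b : ℕ) (J : Finset (ℕ × ℕ)) : Set (ℝ × ℝ) :=
  {p | ∃ d : ℕ → ℕ × ℕ, (∀ i, 1 ≤ i → d i ∈ J) ∧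
    p = (val b (fun i => (d i).1), val b (fun i => (d i).2))}

/-- `J₂(a)`: the digits of `J` lying in row `a`. -/
def J2 (J : Finset (ℕ × ℕ)) (a : ℕ) : Finset (ℕ × ℕ) := J.filter fun p => p.2 = a

/-- The contraction `f_{u,v}(x,y) = ((x+u)/b, (y+v)/b)`. -/
def fmap (b : ℕ) (uv : ℕ × ℕ) (p : ℝ × ℝ) : ℝ × ℝ :=
  ((p.1 + (uv.1 : ℝ)) / b, (p.2 + (uv.2 : ℝ)) / b)

/-- `f_t = f_{u₁,v₁} ∘ ⋯ ∘ f_{uₙ,vₙ}` for a finite word `t = ((u₁,v₁),…,(uₙ,vₙ))`. -/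
def fword (b : ℕ) (t : List (ℕ × ℕ)) (p : ℝ × ℝ) : ℝ × ℝ :=
  t.foldr (fmap b) p

/-- The limsup set `W_{λ,ξ}(z,w)`. -/
def Wset (b : ℕ) (J : Finset (ℕ × ℕ)) (lam xi : ℕ → ℕ) (z w : ℝ) : Set (ℝ × ℝ) :=
  {p | p ∈ carpet b J ∧
    {t : List (ℕ × ℕ) | t ≠ [] ∧ (∀ e ∈ t, e ∈ J) ∧
      |p.1 - (fword b t (z, w)).1| ≤ (b : ℝ) ^ (-(lam t.length : ℤ) - (t.length : ℤ)) ∧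
      |p.2 - (fword b t (z, w)).2| ≤ (b : ℝ) ^ (-(xi t.length : ℤ) - (t.length : ℤ))}.Infinite}

/-- The closeness condition (in one coordinate) defining `M_n(z,w)`:
`xd` is the digit string of the point, `zd` that of the centre, `L` is `λ(n)` or `ξ(n)`. -/
def closeCond (b L n : ℕ) (zd xd : ℕ → ℕ) : Prop :=
  (∀ i, 1 ≤ i → i < L → xd (i + n) = zd i) ∨
  (∃ j, 1 ≤ j ∧ j < L ∧ (∀ i, 1 ≤ i → i ≤ j - 1 → xd (i + n) = zd i) ∧
    (((xd (j + n) : ℤ) - (zd j : ℤ) = -1 ∧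
        ∀ i, j + 1 ≤ i → i < L → (xd (i + n) : ℤ) - (zd i : ℤ) = (b : ℤ) - 1) ∨
     ((xd (j + n) : ℤ) - (zd j : ℤ) = 1 ∧
        ∀ i, j + 1 ≤ i → i < L → (zd i : ℤ) - (xd (i + n) : ℤ) = (b : ℤ) - 1)))

/-- A choice of representative digit sequences for the points of the carpet: each point of `Λ`
gets a digit sequence in `J` representing it, whose partial products of row cardinalities
`∏ #J₂(y_i)` are eventually maximal among all representations of that point. -/
structure RepMap (b : ℕ) (J : Finset (ℕ × ℕ)) where
  rep : ℝ × ℝ → ℕ → ℕ × ℕ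
  mem_J : ∀ p ∈ carpet b J, ∀ i, 1 ≤ i → rep p i ∈ J
  eq_val : ∀ p ∈ carpet b J,
    p = (val b (fun i => (rep p i).1), val b (fun i => (rep p i).2))
  maximal : ∀ p ∈ carpet b J, ∀ d : ℕ → ℕ × ℕ, (∀ i, 1 ≤ i → d i ∈ J) →
    p = (val b (fun i => (d i).1), val b (fun i => (d i).2)) →
    ∃ N₀ : ℕ, ∀ N, N₀ ≤ N →
      ∏ i ∈ Finset.Icc 1 N, (J2 J (d i).2).card ≤
        ∏ i ∈ Finset.Icc 1 N, (J2 J (rep p i).2).card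

/-- The expanding map `T(x,y) = (bx − x₁, by − y₁)`, where `(x_i,y_i)` is the representative
digit sequence of `(x,y)`. -/
def Tmap {b : ℕ} {J : Finset (ℕ × ℕ)} (R : RepMap b J) (p : ℝ × ℝ) : ℝ × ℝ :=
  ((b : ℝ) * p.1 - ((R.rep p 1).1 : ℝ), (b : ℝ) * p.2 - ((R.rep p 1).2 : ℝ))

/-- The shrinking target set `Λ_{λ,ξ}(z,w)`. -/
def targetSet {b : ℕ} {J : Finset (ℕ × ℕ)} (R : RepMap b J) (lam xi : ℕ → ℕ)
    (z w : ℝ) : Set (ℝ × ℝ) :=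
  {p | p ∈ carpet b J ∧ ∃ᶠ n in atTop,
    ((Tmap R)^[n] p).1 ∈ Icc (z - (b : ℝ) ^ (-(lam n : ℤ))) (z + (b : ℝ) ^ (-(lam n : ℤ))) ∧
    ((Tmap R)^[n] p).2 ∈ Icc (w - (b : ℝ) ^ (-(xi n : ℤ))) (w + (b : ℝ) ^ (-(xi n : ℤ)))}

/-- The set `M_n(z,w)` (as a set of points of `Λ`, via representative sequences). -/
def Mset {b : ℕ} {J : Finset (ℕ × ℕ)} (R : RepMap b J) (lam xi : ℕ → ℕ)
    (zw : ℝ × ℝ) (n : ℕ) : Set (ℝ × ℝ) :=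
  {p | p ∈ carpet b J ∧
    closeCond b (lam n) n (fun i => (R.rep zw i).1) (fun i => (R.rep p i).1) ∧
    closeCond b (xi n) n (fun i => (R.rep zw i).2) (fun i => (R.rep p i).2)}

/-- `p_{n,j}(a,y) = #{λ(n) ≤ i ≤ j : y_{i+n} = a}`. -/
def pcount {b : ℕ} {J : Finset (ℕ × ℕ)} (R : RepMap b J) (lam : ℕ → ℕ)
    (p : ℝ × ℝ) (a n j : ℕ) : ℕ :=
  ((Finset.Icc (lam n) j).filter fun i => (R.rep p (i + n)).2 = a).card

/-- `A_{n,j}(z,w) = max_{(x,y) ∈ M_n(z,w)} Σ_a p_{n,j}(a,y) log #J₂(a)`. -/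
def Aval {b : ℕ} {J : Finset (ℕ × ℕ)} (R : RepMap b J) (lam xi : ℕ → ℕ)
    (zw : ℝ × ℝ) (n j : ℕ) : ℝ :=
  sSup ((fun p => ∑ a ∈ Finset.range b,
    (pcount R lam p a n j : ℝ) * Real.log ((J2 J a).card)) '' Mset R lam xi zw n)

/-- `s_n = min{ (n log #J + A_{n,j}(z,w)) / ((n+j) log b) : λ(n) ≤ j ≤ ξ(n) }`. -/
def sval {b : ℕ} {J : Finset (ℕ × ℕ)} (R : RepMap b J) (lam xi : ℕ → ℕ)
    (zw : ℝ × ℝ) (n : ℕ) : ℝ :=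
  sInf ((fun j : ℕ => ((n : ℝ) * Real.log J.card + Aval R lam xi zw n j) /
    (((n : ℝ) + (j : ℝ)) * Real.log b)) '' Set.Icc (lam n) (xi n))

/-- `#{1 ≤ i ≤ n : u i = a}`. -/
def freqCount (u : ℕ → ℕ) (a n : ℕ) : ℕ := ((Finset.Icc 1 n).filter fun i => u i = a).card

/-- The second-coordinate digit string of the representative sequence of a point. -/
def wdig {b : ℕ} {J : Finset (ℕ × ℕ)} (R : RepMap b J) (zw : ℝ × ℝ) (i : ℕ) : ℕ :=
  (R.rep zw i).2

theorem summable_digits {b : ℕ} (hb : 2 ≤ b) {u : ℕ → ℕ} (hu : ∀ i, 1 ≤ i → u i < b) :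
    Summable fun i : ℕ => (u (i + 1) : ℝ) / (b : ℝ) ^ (i + 1) := by
  have hb2 : (2 : ℝ) ≤ b := by exact_mod_cast hb
  refine Summable.of_nonneg_of_le (fun i => by positivity) (fun i => ?_)
    (summable_geometric_of_lt_one (r := (b : ℝ)⁻¹) (by positivity)
      (inv_lt_one_of_one_lt₀ (by linarith)))
  have h1 : (u (i + 1) : ℝ) ≤ b := by exact_mod_cast (hu (i + 1) (by omega)).le
  rw [inv_pow, div_le_iff₀ (by positivity), pow_succ, ← mul_assoc,
    inv_mul_cancel₀ (by positivity), one_mul]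
  exact h1

theorem mul_val {b : ℕ} (hb : 2 ≤ b) {u : ℕ → ℕ} (hu : ∀ i, 1 ≤ i → u i < b) :
    (b : ℝ) * val b u = u 1 + val b fun i => u (i + 1) := by
  have hb0 : (b : ℝ) ≠ 0 := by
    have : b ≠ 0 := by omega
    exact_mod_cast this
  unfold val
  rw [(summable_digits hb hu).tsum_eq_zero_add, mul_add, ← tsum_mul_left]
  congr 1
  · simp only [zero_add, pow_one]
    field_simp
  · refine tsum_congr fun i => ?_
    rw [pow_succ (b : ℝ) (i + 1)]
    field_simp

theorem val_mem_Icc {b : ℕ} (hb : 2 ≤ b) {u : ℕ → ℕ} (hu : ∀ i, 1 ≤ i → u i < b) :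
    val b u ∈ Icc (0 : ℝ) 1 := by
  have hb2 : (2 : ℝ) ≤ b := by exact_mod_cast hb
  refine ⟨tsum_nonneg fun i => by positivity, ?_⟩
  have hgeom : HasSum (fun i : ℕ => ((b : ℝ) - 1) / (b : ℝ) ^ (i + 1)) 1 := by
    have h := (hasSum_geometric_of_lt_one (r := (b : ℝ)⁻¹) (by positivity)
      (inv_lt_one_of_one_lt₀ (by linarith))).mul_left (((b : ℝ) - 1) / b)
    have hb1 : (b : ℝ) - 1 ≠ 0 := by linarith
    have hsum : ((b : ℝ) - 1) / b * (1 - (b : ℝ)⁻¹)⁻¹ = 1 := by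
      have hb1' : 1 - (b : ℝ)⁻¹ = (b - 1) / b := by field_simp
      rw [hb1']
      field_simp
    rw [hsum] at h
    have hterm (i : ℕ) :
        ((b : ℝ) - 1) / (b : ℝ) ^ (i + 1) = ((b : ℝ) - 1) / b * (b : ℝ)⁻¹ ^ i := by
      rw [pow_succ, inv_pow]
      field_simp
    simpa only [hterm] using h
  rw [← hgeom.tsum_eq]
  refine (summable_digits hb hu).tsum_le_tsum (fun i => ?_) hgeom.summable
  have h1 : (u (i + 1) : ℝ) + 1 ≤ b := by exact_mod_cast hu (i + 1) (by omega)
  gcongr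
  linarith

section Carpet

variable {b : ℕ} {J : Finset (ℕ × ℕ)}

theorem carpet_subset_unit_square (hb : 2 ≤ b) (hJ : J ⊆ Finset.range b ×ˢ Finset.range b)
    {p : ℝ × ℝ} (hp : p ∈ carpet b J) : p.1 ∈ Icc (0 : ℝ) 1 ∧ p.2 ∈ Icc (0 : ℝ) 1 := by
  obtain ⟨d, hd, rfl⟩ := hp
  have hdb (i : ℕ) (hi : 1 ≤ i) : (d i).1 < b ∧ (d i).2 < b := by
    simpa using hJ (hd i hi)
  exact ⟨val_mem_Icc hb fun i hi => (hdb i hi).1, val_mem_Icc hb fun i hi => (hdb i hi).2⟩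

theorem Tmap_mem_carpet (hb : 2 ≤ b) (hJ : J ⊆ Finset.range b ×ˢ Finset.range b)
    (R : RepMap b J) {p : ℝ × ℝ} (hp : p ∈ carpet b J) : Tmap R p ∈ carpet b J := by
  refine ⟨fun i => R.rep p (i + 1), fun i _ => R.mem_J p hp _ (by omega), ?_⟩
  have hdb (i : ℕ) (hi : 1 ≤ i) : (R.rep p i).1 < b ∧ (R.rep p i).2 < b := by
    simpa using hJ (R.mem_J p hp i hi)
  have h1 := mul_val hb (u := fun i => (R.rep p i).1) fun i hi => (hdb i hi).1
  have h2 := mul_val hb (u := fun i => (R.rep p i).2) fun i hi => (hdb i hi).2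
  have hp1 : p.1 = val b fun i => (R.rep p i).1 := congrArg Prod.fst (R.eq_val p hp)
  have hp2 : p.2 = val b fun i => (R.rep p i).2 := congrArg Prod.snd (R.eq_val p hp)
  rw [← hp1] at h1
  rw [← hp2] at h2
  ext
  · simp only [Tmap, h1]
    ring
  · simp only [Tmap, h2]
    ring

theorem iterate_Tmap_mem_carpet (hb : 2 ≤ b) (hJ : J ⊆ Finset.range b ×ˢ Finset.range b)
    (R : RepMap b J) {p : ℝ × ℝ} (hp : p ∈ carpet b J) (n : ℕ) :
    (Tmap R)^[n] p ∈ carpet b J := by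
  induction n with
  | zero => exact hp
  | succ n ih =>
    rw [Function.iterate_succ_apply']
    exact Tmap_mem_carpet hb hJ R ih

theorem fmap_Tmap (hb : b ≠ 0) (R : RepMap b J) (p : ℝ × ℝ) :
    fmap b (R.rep p 1) (Tmap R p) = p := by
  have hb0 : (b : ℝ) ≠ 0 := by exact_mod_cast hb
  ext <;> simp [fmap, Tmap, hb0]

/-- Every point of the carpet is the image of its `n`-th iterate under a word of length `n`. -/
theorem exists_fword_iterate_Tmap (hb : 2 ≤ b) (hJ : J ⊆ Finset.range b ×ˢ Finset.range b)
    (R : RepMap b J) (n : ℕ) {p : ℝ × ℝ} (hp : p ∈ carpet b J) :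
    ∃ t : List (ℕ × ℕ), t.length = n ∧ (∀ e ∈ t, e ∈ J) ∧
      fword b t ((Tmap R)^[n] p) = p := by
  induction n generalizing p with
  | zero => exact ⟨[], rfl, by simp, rfl⟩
  | succ n ih =>
    obtain ⟨t, ht, htJ, hfix⟩ := ih (Tmap_mem_carpet hb hJ R hp)
    refine ⟨R.rep p 1 :: t, by simp [ht], ?_, ?_⟩
    · simpa using ⟨R.mem_J p hp 1 le_rfl, fun a c h => htJ (a, c) h⟩
    · rw [Function.iterate_succ_apply]
      change fmap b _ (fword b t _) = p
      rw [hfix, fmap_Tmap (by omega)]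

/-- A word acts as `q ↦ b⁻ⁿ (q + k)` for an integer vector `k`. -/
theorem exists_pow_mul_fword (hb : b ≠ 0) (t : List (ℕ × ℕ)) :
    ∃ k l : ℤ, ∀ q : ℝ × ℝ, (b : ℝ) ^ t.length * (fword b t q).1 = q.1 + k ∧
      (b : ℝ) ^ t.length * (fword b t q).2 = q.2 + l := by
  have hb0 : (b : ℝ) ≠ 0 := by exact_mod_cast hb
  induction t with
  | nil => exact ⟨0, 0, fun q => by simp [fword]⟩
  | cons e t ih =>
    obtain ⟨k, l, h⟩ := ih
    refine ⟨k + b ^ t.length * e.1, l + b ^ t.length * e.2, fun q => ?_⟩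
    obtain ⟨h1, h2⟩ := h q
    have hcons : fword b (e :: t) q = fmap b e (fword b t q) := rfl
    rw [hcons]
    simp only [fmap, List.length_cons, pow_succ]
    push_cast
    constructor
    · rw [mul_assoc, mul_div_cancel₀ _ hb0, mul_add, h1]
      ring
    · rw [mul_assoc, mul_div_cancel₀ _ hb0, mul_add, h2]
      ring

theorem finite_words_length_le (J : Finset (ℕ × ℕ)) (n : ℕ) :
    {t : List (ℕ × ℕ) | t.length ≤ n ∧ ∀ e ∈ t, e ∈ J}.Finite := by
  refine ((List.finite_length_le J n).image (List.map Subtype.val)).subset ?_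
  rintro t ⟨hn, htJ⟩
  lift t to List J using htJ
  exact ⟨t, by simpa using hn, rfl⟩

theorem abs_le_zpow_iff (hb : b ≠ 0) (x : ℝ) (m n : ℕ) :
    |x| ≤ (b : ℝ) ^ (-(m : ℤ) - (n : ℤ)) ↔ |(b : ℝ) ^ n * x| ≤ (b : ℝ) ^ (-(m : ℤ)) := by
  have hb0 : (0 : ℝ) < b := by exact_mod_cast Nat.pos_of_ne_zero hb
  rw [zpow_sub₀ hb0.ne', zpow_natCast, le_div_iff₀ (by positivity), abs_mul,
    abs_of_pos (pow_pos hb0 n), mul_comm]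

theorem mem_Icc_sub_add_iff (x c r : ℝ) : x ∈ Icc (c - r) (c + r) ↔ |x - c| ≤ r := by
  rw [abs_le, mem_Icc]
  constructor <;> rintro ⟨h1, h2⟩ <;> constructor <;> linarith

theorem targetSet_subset_Wset (hb : 2 ≤ b) (hJ : J ⊆ Finset.range b ×ˢ Finset.range b)
    (R : RepMap b J) (lam xi : ℕ → ℕ) (z w : ℝ) :
    targetSet R lam xi z w ⊆ Wset b J lam xi z w := by
  rintro p ⟨hp, hfreq⟩
  refine ⟨hp, fun hfin => ?_⟩
  obtain ⟨N, hN⟩ := (hfin.image List.length).bddAbove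
  obtain ⟨n, hn, h1, h2⟩ := frequently_atTop.1 hfreq (N + 1)
  obtain ⟨t, rfl, htJ, ht⟩ := exists_fword_iterate_Tmap hb hJ R n hp
  rw [mem_Icc_sub_add_iff] at h1 h2
  obtain ⟨k, l, hkl⟩ := exists_pow_mul_fword (b := b) (by omega) t
  obtain ⟨hz, hw⟩ := hkl (z, w)
  obtain ⟨hx, hy⟩ := hkl ((Tmap R)^[t.length] p)
  rw [ht] at hx hy
  refine absurd (hN (mem_image_of_mem _ ⟨?_, htJ, ?_, ?_⟩)) (not_le.2 hn)
  · rintro rfl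
    simp at hn
  · rwa [abs_le_zpow_iff (by omega), mul_sub, hx, hz, add_sub_add_right_eq_sub]
  · rwa [abs_le_zpow_iff (by omega), mul_sub, hy, hw, add_sub_add_right_eq_sub]

theorem intCast_mem_of_abs_sub_add_le {x z r : ℝ} {k : ℤ} (hx : x ∈ Icc (0 : ℝ) 1)
    (hz : z ∈ Icc (0 : ℝ) 1) (hr : r < 1) (h : |x - (z + k)| ≤ r) :
    (k : ℝ) ∈ ({-1, 0, 1} : Set ℝ) := by
  rw [abs_le] at h
  have h1 : (k : ℝ) < (2 : ℤ) := by
    push_cast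
    linarith [hx.1, hx.2, hz.1, hz.2]
  have h2 : ((-2 : ℤ) : ℝ) < k := by
    push_cast
    linarith [hx.1, hx.2, hz.1, hz.2]
  rw [Int.cast_lt] at h1 h2
  obtain rfl | rfl | rfl : k = -1 ∨ k = 0 ∨ k = 1 := by omega
  all_goals simp

theorem Wset_subset_iUnion_targetSet (hb : 2 ≤ b) (hJ : J ⊆ Finset.range b ×ˢ Finset.range b)
    (R : RepMap b J) {lam xi : ℕ → ℕ} (hlam : ∀ n, 1 ≤ lam n) (hxi : ∀ n, 1 ≤ xi n)
    {z w : ℝ} (hz : z ∈ Icc (0 : ℝ) 1) (hw : w ∈ Icc (0 : ℝ) 1) :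
    Wset b J lam xi z w ⊆
      ⋃ r ∈ ({-1, 0, 1} : Set ℝ), ⋃ s ∈ ({-1, 0, 1} : Set ℝ),
        targetSet R lam xi (z + r) (w + s) := by
  rintro p ⟨hp, hinf⟩
  have hsmall (m : ℕ) (hm : 1 ≤ m) : (b : ℝ) ^ (-(m : ℤ)) < 1 :=
    zpow_lt_one_of_neg₀ (by exact_mod_cast hb) (by omega)
  have hfreq : ∃ᶠ n in atTop, ∃ q ∈ ({-1, 0, 1} : Set ℝ) ×ˢ ({-1, 0, 1} : Set ℝ),
      |((Tmap R)^[n] p).1 - (z + q.1)| ≤ (b : ℝ) ^ (-(lam n : ℤ)) ∧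
      |((Tmap R)^[n] p).2 - (w + q.2)| ≤ (b : ℝ) ^ (-(xi n : ℤ)) := by
    refine frequently_atTop.2 fun N => ?_
    obtain ⟨t, ⟨-, htJ, h1, h2⟩, htN⟩ := (hinf.sdiff (finite_words_length_le J N)).nonempty
    have hN : N ≤ t.length := by
      by_contra hlt
      exact htN ⟨by omega, htJ⟩
    refine ⟨t.length, hN, ?_⟩
    obtain ⟨t', ht', -, hfix⟩ := exists_fword_iterate_Tmap hb hJ R t.length hp
    obtain ⟨k', l', hkl'⟩ := exists_pow_mul_fword (b := b) (by omega) t'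
    obtain ⟨hx, hy⟩ := hkl' ((Tmap R)^[t.length] p)
    rw [hfix, ht'] at hx hy
    obtain ⟨k, l, hkl⟩ := exists_pow_mul_fword (b := b) (by omega) t
    obtain ⟨hk, hl⟩ := hkl (z, w)
    rw [abs_le_zpow_iff (by omega), mul_sub, hx, hk] at h1
    rw [abs_le_zpow_iff (by omega), mul_sub, hy, hl] at h2
    have h1' : |((Tmap R)^[t.length] p).1 - (z + (k - k' : ℤ))| ≤
        (b : ℝ) ^ (-(lam t.length : ℤ)) := by
      convert h1 using 2
      push_cast
      ring
    have h2' : |((Tmap R)^[t.length] p).2 - (w + (l - l' : ℤ))| ≤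
        (b : ℝ) ^ (-(xi t.length : ℤ)) := by
      convert h2 using 2
      push_cast
      ring
    obtain ⟨hT1, hT2⟩ := carpet_subset_unit_square hb hJ
      (iterate_Tmap_mem_carpet hb hJ R hp t.length)
    exact ⟨(_, _), ⟨intCast_mem_of_abs_sub_add_le hT1 hz (hsmall _ (hlam _)) h1',
      intCast_mem_of_abs_sub_add_le hT2 hw (hsmall _ (hxi _)) h2'⟩, h1', h2'⟩
  have hfinite : (({-1, 0, 1} : Set ℝ) ×ˢ ({-1, 0, 1} : Set ℝ)).Finite :=
    (toFinite _).prod (toFinite _)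
  obtain ⟨⟨r, s⟩, ⟨hr, hs⟩, hrs⟩ : ∃ q ∈ ({-1, 0, 1} : Set ℝ) ×ˢ ({-1, 0, 1} : Set ℝ),
      ∃ᶠ n in atTop, |((Tmap R)^[n] p).1 - (z + q.1)| ≤ (b : ℝ) ^ (-(lam n : ℤ)) ∧
        |((Tmap R)^[n] p).2 - (w + q.2)| ≤ (b : ℝ) ^ (-(xi n : ℤ)) := by
    by_contra hnot
    refine hfreq ?_
    filter_upwards [(eventually_all_finite hfinite).2 fun q hq =>
      not_frequently.1 fun h => hnot ⟨q, hq, h⟩] with n hn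
    rintro ⟨q, hq, h⟩
    exact hn q hq h
  simp only [mem_iUnion]
  refine ⟨r, hr, s, hs, hp, hrs.mono fun n hn => ?_⟩
  rwa [mem_Icc_sub_add_iff, mem_Icc_sub_add_iff]

end Carpet

theorem stmt_2
    (b : ℕ) (J : Finset (ℕ × ℕ)) (hb : 2 ≤ b)
    (hJ : J ⊂ Finset.range b ×ˢ Finset.range b) (hJcard : 2 ≤ J.card)
    (R : RepMap b J) (lam xi : ℕ → ℕ)
    (hlam_pos : ∀ n, 1 ≤ lam n) (hle : ∀ n, lam n ≤ xi n)
    (hlam_top : Tendsto lam atTop atTop)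
    (z w : ℝ) (hzw : (z, w) ∈ carpet b J)
    (h01 : z = 0 ∨ z = 1 ∨ w = 0 ∨ w = 1) :
    targetSet R lam xi z w ⊆ Wset b J lam xi z w ∧
    Wset b J lam xi z w ⊆
      ⋃ r ∈ ({-1, 0, 1} : Set ℝ), ⋃ s ∈ ({-1, 0, 1} : Set ℝ),
        targetSet R lam xi (z + r) (w + s) := by
  obtain ⟨hz, hw⟩ := carpet_subset_unit_square hb hJ.subset hzw
  exact ⟨targetSet_subset_Wset hb hJ.subset R lam xi z w,
    Wset_subset_iUnion_targetSet hb hJ.subset R hlam_pos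
      (fun n => (hlam_pos n).trans (hle n)) hz hw⟩

end ShrinkingRect
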